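/- arXiv:1701.06065 — 2 statements merged into one kernel-verified Lean document; each statement's English description precedes it below -/
import Mathlib

section
/- The quintic X⁴Y + Y⁴Z + Z⁴X = 0 defines a smooth plane curve over any algebraically closed field of characteristic 0 or p > 13, and the projective transformations [X:Y:Z] ↦ [X : ζ₁₃Y : ζ₁₃¹⁰Z] and [X:Y:Z] ↦ [Y:Z:X] are automorphisms of it. -/
open MvPolynomial

/-- Primes `q ≤ 13` are nonzero in a field whose characteristic is `0` or larger than `13`. -/
theorem natCast_ne_zero_of_char_gt {k : Type*} [Field k]
    (hchar : ∀ p : ℕ, CharP k p → p = 0 ∨ 13 < p) {q : ℕ} (hq : q.Prime) (hq13 : q ≤ 13) :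
    (q : k) ≠ 0 := by
  intro h
  have := hchar q ((CharP.charP_iff_prime_eq_zero hq).2 h)
  have := hq.pos
  omega

/-- The partial derivatives of `X⁴Y + Y⁴Z + Z⁴X` have no common nontrivial zero when `5` and `13`
are invertible. -/
theorem eq_zero_of_quintic_partials_eq_zero {k : Type*} [Field k]
    (h5 : (5 : k) ≠ 0) (h13 : (13 : k) ≠ 0) {x y z : k}
    (hx : 4 * x ^ 3 * y + z ^ 4 = 0) (hy : x ^ 4 + 4 * y ^ 3 * z = 0)
    (hz : y ^ 4 + 4 * z ^ 3 * x = 0) : x = 0 ∧ y = 0 ∧ z = 0 := by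
  have h : (5 * 13) * (x ^ 4 * y) = 0 := by
    linear_combination 16 * x * hx + y * hy - 4 * z * hz
  have hxy : x = 0 ∨ y = 0 := by simpa [h5, h13] using h
  rcases hxy with rfl | rfl <;> simp_all

/-- The quintic `X⁴Y + Y⁴Z + Z⁴X = 0` is a smooth plane curve over any algebraically closed
field of characteristic `0` or `p > 13`, and `[X:Y:Z] ↦ [X : ζ₁₃Y : ζ₁₃¹⁰Z]` and
`[X:Y:Z] ↦ [Y:Z:X]` are automorphisms of it. -/
theorem quintic_klein_like_smooth_and_automorphisms {k : Type*} [Field k] [IsAlgClosed k]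
    (hchar : ∀ p : ℕ, CharP k p → p = 0 ∨ 13 < p)
    (ζ : k) (hζ : IsPrimitiveRoot ζ 13) :
    (∀ P : Fin 3 → k,
      eval P ((X 0) ^ 4 * X 1 + (X 1) ^ 4 * X 2 + (X 2) ^ 4 * X 0 :
        MvPolynomial (Fin 3) k) = 0 →
      (∀ i : Fin 3, eval P (pderiv i ((X 0) ^ 4 * X 1 + (X 1) ^ 4 * X 2 + (X 2) ^ 4 * X 0 :
        MvPolynomial (Fin 3) k)) = 0) → P = 0) ∧
    (∀ x y z : k, x ^ 4 * y + y ^ 4 * z + z ^ 4 * x = 0 →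
      x ^ 4 * (ζ * y) + (ζ * y) ^ 4 * (ζ ^ 10 * z) + (ζ ^ 10 * z) ^ 4 * x = 0) ∧
    (∀ x y z : k, x ^ 4 * y + y ^ 4 * z + z ^ 4 * x = 0 →
      y ^ 4 * z + z ^ 4 * x + x ^ 4 * y = 0) := by
  refine ⟨fun P _ hP => ?_, fun x y z h => ?_, fun x y z h => ?_⟩
  · have hx := hP 0
    have hy := hP 1
    have hz := hP 2
    simp [pderiv_X] at hx hy hz
    have h5 : (5 : k) ≠ 0 := by
      exact_mod_cast natCast_ne_zero_of_char_gt hchar (q := 5) (by norm_num) (by norm_num)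
    have h13 : (13 : k) ≠ 0 := by
      exact_mod_cast natCast_ne_zero_of_char_gt hchar (q := 13) (by norm_num) (by norm_num)
    obtain ⟨h0, h1, h2⟩ := eq_zero_of_quintic_partials_eq_zero h5 h13
      (x := P 0) (y := P 1) (z := P 2) (by linear_combination hx) (by linear_combination hy)
      (by linear_combination hz)
    ext i
    fin_cases i <;> assumption
  · have h1 := hζ.pow_eq_one
    linear_combination ζ * h + ζ * y ^ 4 * z * h1 + ζ * (ζ ^ 26 + ζ ^ 13 + 1) * z ^ 4 * x * h1
  · linear_combination h
end

section
/- The group of Möbius transformations permuting the set {0, 1, ∞, a, b} (for generic distinct a, b ∈ k̄ \ {0,1}), acting as permutations of these five points, is isomorphic to a subgroup of S₅; the transformations τ₁(a,b) = (a, a(b-1)/(b-a)) and τ₂(a,b) = (1/b, a/b) satisfy τ₁² = τ₂³ = (τ₁τ₂)⁵ = identity, generating a group isomorphic to A₅. -/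
/-- A correspondence between generators of a group `S` and elements of `G` extends to a
homomorphism as soon as the subgroup it generates in `S × G` meets `1 × G` trivially. -/
lemma MonoidHom.exists_of_closure_pair {S G : Type*} [Group S] [Group G] {s₁ s₂ : S} {g₁ g₂ : G}
    (hs : Subgroup.closure {s₁, s₂} = ⊤)
    (h : ∀ g, ((1 : S), g) ∈ Subgroup.closure {(s₁, g₁), (s₂, g₂)} → g = 1) :
    ∃ ψ : S →* G, ψ s₁ = g₁ ∧ ψ s₂ = g₂ := by
  set H := Subgroup.closure {(s₁, g₁), (s₂, g₂)} with hH
  let π : H →* S := (MonoidHom.fst S G).comp H.subtype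
  have h₁ : (s₁, g₁) ∈ H := Subgroup.subset_closure (by simp)
  have h₂ : (s₂, g₂) ∈ H := Subgroup.subset_closure (by simp)
  have hinj : Function.Injective π := by
    rw [injective_iff_map_eq_one]
    rintro ⟨⟨s, g⟩, hx⟩ (rfl : s = 1)
    exact Subtype.ext (Prod.ext rfl (h g hx))
  have hsurj : Function.Surjective π := by
    rw [← MonoidHom.range_eq_top, ← top_le_iff, ← hs, Subgroup.closure_le]
    rintro s (rfl | rfl)
    exacts [⟨⟨_, h₁⟩, rfl⟩, ⟨⟨_, h₂⟩, rfl⟩]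
  let e := MulEquiv.ofBijective π ⟨hinj, hsurj⟩
  refine ⟨((MonoidHom.snd S G).comp H.subtype).comp e.symm.toMonoidHom, ?_, ?_⟩
  · have : e.symm s₁ = ⟨_, h₁⟩ := e.symm_apply_eq.2 rfl
    simp [this]
  · have : e.symm s₂ = ⟨_, h₂⟩ := e.symm_apply_eq.2 rfl
    simp [this]

/-- A nontrivial homomorphism out of a simple group with two generators identifies that group
with the subgroup generated by the images of the generators. -/
lemma MonoidHom.nonempty_closure_pair_mulEquiv {S G : Type*} [Group S] [IsSimpleGroup S] [Group G]
    (ψ : S →* G) {s₁ s₂ : S} (hs : Subgroup.closure {s₁, s₂} = ⊤) (h : ψ s₁ ≠ 1) :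
    Nonempty (Subgroup.closure {ψ s₁, ψ s₂} ≃* S) := by
  have hinj : Function.Injective ψ := by
    rw [← MonoidHom.ker_eq_bot_iff]
    refine (IsSimpleGroup.eq_bot_or_eq_top_of_normal _ ψ.normal_ker).resolve_right fun htop ↦ h ?_
    exact MonoidHom.mem_ker.1 (htop ▸ Subgroup.mem_top s₁)
  have hrange : ψ.range = Subgroup.closure {ψ s₁, ψ s₂} := by
    rw [MonoidHom.range_eq_map, ← hs, MonoidHom.map_closure, Set.image_pair]
  rw [← hrange]
  exact ⟨(MonoidHom.ofInjective hinj).symm⟩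

/-- Two elements of `A₅` of orders 2 and 3 whose product has order 5 generate `A₅`. -/
lemma alternatingGroup.closure_pair_eq_top {s₁ s₂ : alternatingGroup (Fin 5)}
    (h₁ : orderOf s₁ = 2) (h₂ : orderOf s₂ = 3) (h₃ : orderOf (s₁ * s₂) = 5) :
    Subgroup.closure {s₁, s₂} = ⊤ := by
  set H := Subgroup.closure {s₁, s₂}
  have m₁ : s₁ ∈ H := Subgroup.subset_closure (by simp)
  have m₂ : s₂ ∈ H := Subgroup.subset_closure (by simp)
  have d₁ := Subgroup.orderOf_dvd_natCard H m₁
  rw [h₁] at d₁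
  have d₂ := Subgroup.orderOf_dvd_natCard H m₂
  rw [h₂] at d₂
  have d₃ := Subgroup.orderOf_dvd_natCard H (mul_mem m₁ m₂)
  rw [h₃] at d₃
  have hcard : Nat.card H * H.index = 60 := by
    rw [Subgroup.card_mul_index, nat_card_alternatingGroup]
    simp [Nat.factorial]
  have hd : 30 ∣ Nat.card H := by lia
  obtain ⟨c, hc⟩ := hd
  have hidx : H.index ∣ 2 := ⟨c, by rw [hc] at hcard; lia⟩
  rcases (Nat.dvd_prime Nat.prime_two).1 hidx with hi | hi
  · exact Subgroup.index_eq_one.1 hi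
  · refine (IsSimpleGroup.eq_bot_or_eq_top_of_normal H
      (Subgroup.normal_of_index_eq_two hi)).resolve_left fun hbot ↦ ?_
    rw [hbot, Subgroup.card_bot] at d₁
    lia

/-- If a family of elements generates the rational function field and has as many members as
there are variables, then substituting it for the variables is an automorphism. -/
lemma MvPolynomial.exists_fractionRing_algEquiv {k : Type*} [Field k] {ι : Type*} [Finite ι]
    (f : ι → FractionRing (MvPolynomial ι k))
    (hf : ∀ i, algebraMap (MvPolynomial ι k) (FractionRing (MvPolynomial ι k)) (X i) ∈
      IntermediateField.adjoin k (Set.range f)) :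
    ∃ σ : FractionRing (MvPolynomial ι k) ≃ₐ[k] FractionRing (MvPolynomial ι k),
      ∀ i, σ (algebraMap (MvPolynomial ι k) _ (X i)) = f i := by
  have htop : IntermediateField.adjoin k (Set.range f) = ⊤ := by
    rw [eq_top_iff]
    intro x _
    have hpoly (p : MvPolynomial ι k) : algebraMap _ (FractionRing (MvPolynomial ι k)) p ∈
        IntermediateField.adjoin k (Set.range f) := by
      induction p using MvPolynomial.induction_on with
      | C a =>
        rw [← MvPolynomial.algebraMap_eq, ← IsScalarTower.algebraMap_apply]
        exact IntermediateField.algebraMap_mem _ a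
      | add p q hp hq => rw [map_add]; exact add_mem hp hq
      | mul_X p i hp => rw [map_mul]; exact mul_mem hp (hf i)
    obtain ⟨p, q, -, rfl⟩ := IsFractionRing.div_surjective (A := MvPolynomial ι k) x
    exact div_mem (hpoly p) (hpoly q)
  have hgen : Algebra.IsAlgebraic (Algebra.adjoin k (Set.range f))
      (FractionRing (MvPolynomial ι k)) := by
    refine ⟨fun x ↦ ?_⟩
    have hx : x ∈ IntermediateField.adjoin k (Set.range f) := htop ▸ trivial
    obtain ⟨r, hr, s, hs, rfl⟩ := IntermediateField.mem_adjoin_iff_div.1 hx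
    rw [div_eq_mul_inv]
    exact (isAlgebraic_algebraMap (⟨r, hr⟩ : Algebra.adjoin k (Set.range f))).mul
      (isAlgebraic_algebraMap (⟨s, hs⟩ : Algebra.adjoin k (Set.range f))).inv
  have : Algebra.IsAlgebraic (MvPolynomial ι k) (FractionRing (MvPolynomial ι k)) :=
    IsLocalization.isAlgebraic _ (nonZeroDivisors _)
  have hX : IsTranscendenceBasis k (algebraMap (MvPolynomial ι k)
      (FractionRing (MvPolynomial ι k)) ∘ X) :=
    (IsTranscendenceBasis.mvPolynomial ι k).algebraMap_comp
  have hind : AlgebraicIndependent k f :=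
    (Algebra.IsAlgebraic.isTranscendenceBasis_of_lift_le_trdeg_of_finite k f hX.lift_cardinalMk_eq_trdeg.le).1
  refine ⟨hind.aevalEquivField.trans
    ((IntermediateField.equivOfEq htop).trans IntermediateField.topEquiv), fun i ↦ ?_⟩
  have := hind.aevalEquivField_algebraMap_apply_coe (X i)
  rw [MvPolynomial.aeval_X] at this
  exact this

section CrossRatio

variable {K ι : Type*} [Field K]

/-- The cross-ratio of four members of a family of points of `ℙ¹(K)` with homogeneous
coordinates `(P i : Q i)`. -/
def crossRatio (P Q : ι → K) (i j l m : ι) : K :=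
  ((P i * Q j - P j * Q i) * (P l * Q m - P m * Q l)) /
    ((P i * Q m - P m * Q i) * (P l * Q j - P j * Q l))

/-- If a field homomorphism `g` moves a family of points of `ℙ¹(K)` as the permutation `p`
followed by a Möbius transformation, then it moves the cross-ratios as `p` does. -/
lemma map_crossRatio (g : K →+* K) (p : ι → ι) (P Q s : ι → K) (a b c d : K)
    (hdet : a * d - b * c ≠ 0) (hs : ∀ i, s i ≠ 0)
    (hP : ∀ i, s i * g (P i) = a * P (p i) + b * Q (p i))
    (hQ : ∀ i, s i * g (Q i) = c * P (p i) + d * Q (p i)) (i j l m : ι) :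
    g (crossRatio P Q i j l m) = crossRatio P Q (p i) (p j) (p l) (p m) := by
  have key (i j : ι) : g (P i * Q j - P j * Q i) =
      (a * d - b * c) * (P (p i) * Q (p j) - P (p j) * Q (p i)) / (s i * s j) := by
    rw [eq_div_iff (mul_ne_zero (hs i) (hs j)), map_sub, map_mul, map_mul]
    linear_combination s j * g (Q j) * hP i + (a * P (p i) + b * Q (p i)) * hQ j
      - s i * g (Q i) * hP j - (a * P (p j) + b * Q (p j)) * hQ i
  have h1 := hs i
  have h2 := hs j
  have h3 := hs l
  have h4 := hs m
  simp only [crossRatio, map_div₀, map_mul (g : K →+* K) (_ - _), key]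
  generalize a * d - b * c = D at hdet
  generalize P (p i) * Q (p j) - P (p j) * Q (p i) = x
  generalize P (p l) * Q (p m) - P (p m) * Q (p l) = y
  generalize P (p i) * Q (p m) - P (p m) * Q (p i) = z
  generalize P (p l) * Q (p j) - P (p j) * Q (p l) = w
  rw [show D * x / (s i * s j) * (D * y / (s l * s m)) = D ^ 2 / (s i * s j * s l * s m) * (x * y)
      by field_simp,
    show D * z / (s i * s m) * (D * w / (s l * s j)) = D ^ 2 / (s i * s j * s l * s m) * (z * w)
      by field_simp]
  exact mul_div_mul_left _ _ (div_ne_zero (pow_ne_zero 2 hdet)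
    (mul_ne_zero (mul_ne_zero (mul_ne_zero h1 h2) h3) h4))

end CrossRatio

/-- Field automorphisms acting on cross-ratios through given permutations: this compatibility
passes to the subgroup generated by the pairs. -/
lemma crossRatio_of_mem_closure {k K ι : Type*} [Field k] [Field K] [Algebra k K]
    {S : Subgroup (Equiv.Perm ι)} (P Q : ι → K) (T : Set (S × (K ≃ₐ[k] K)))
    (hT : ∀ x ∈ T, ∀ i j l m, x.2 (crossRatio P Q i j l m) =
      crossRatio P Q (x.1.1 i) (x.1.1 j) (x.1.1 l) (x.1.1 m))
    {x : S × (K ≃ₐ[k] K)} (hx : x ∈ Subgroup.closure T) (i j l m : ι) :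
    x.2 (crossRatio P Q i j l m) =
      crossRatio P Q (x.1.1 i) (x.1.1 j) (x.1.1 l) (x.1.1 m) := by
  induction hx using Subgroup.closure_induction generalizing i j l m with
  | mem x hx => exact hT x hx i j l m
  | one => rfl
  | mul x y _ _ hx hy =>
    simp only [Prod.snd_mul, Prod.fst_mul, AlgEquiv.mul_apply, hy, hx, Subgroup.coe_mul,
      Equiv.Perm.mul_apply]
  | inv x _ hx =>
    apply x.2.injective
    rw [hx, Prod.snd_inv, ← AlgEquiv.mul_apply, mul_inv_cancel]
    simp


/-- The action on `(0, 1, ∞, a, b)` of the Möbius transformation underlying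
`(a, b) ↦ (a, a(b-1)/(b-a))`. -/
def moebiusPerm₁ : alternatingGroup (Fin 5) :=
  ⟨Equiv.swap 0 1 * Equiv.swap 2 3, Equiv.Perm.mem_alternatingGroup.2 (by decide)⟩

/-- The action on `(0, 1, ∞, a, b)` of the Möbius transformation underlying
`(a, b) ↦ (1/b, a/b)`. -/
def moebiusPerm₂ : alternatingGroup (Fin 5) :=
  ⟨Equiv.swap 1 4 * Equiv.swap 4 3, Equiv.Perm.mem_alternatingGroup.2 (by decide)⟩

lemma moebiusPerm₁_sq : moebiusPerm₁ ^ 2 = 1 := by decide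

lemma moebiusPerm₂_cube : moebiusPerm₂ ^ 3 = 1 := by decide

lemma moebiusPerm₁_mul_moebiusPerm₂_pow : (moebiusPerm₁ * moebiusPerm₂) ^ 5 = 1 := by decide

lemma closure_moebiusPerm : Subgroup.closure {moebiusPerm₁, moebiusPerm₂} = ⊤ := by
  have := Fact.mk Nat.prime_five
  exact alternatingGroup.closure_pair_eq_top
    (orderOf_eq_prime moebiusPerm₁_sq (by decide))
    (orderOf_eq_prime moebiusPerm₂_cube (by decide))
    (orderOf_eq_prime moebiusPerm₁_mul_moebiusPerm₂_pow (by decide))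

/-- Field automorphisms acting on `a` and `b` by the two basic transformations yield an action of
`A₅`, provided the only automorphism fixing `a` and `b` is the identity. -/
lemma exists_hom_of_moebius {k K : Type*} [Field k] [Field K] [Algebra k K] {A B : K}
    (hA0 : A ≠ 0) (hB0 : B ≠ 0) (hA1 : A - 1 ≠ 0) (hBA : B - A ≠ 0) {τ₁ τ₂ : K ≃ₐ[k] K}
    (h1A : τ₁ A = A) (h1B : τ₁ B = A * (B - 1) / (B - A)) (h2A : τ₂ A = B⁻¹) (h2B : τ₂ B = A / B)
    (hext : ∀ g : K ≃ₐ[k] K, g A = A → g B = B → g = 1) :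
    ∃ ψ : alternatingGroup (Fin 5) →* (K ≃ₐ[k] K),
      ψ moebiusPerm₁ = τ₁ ∧ ψ moebiusPerm₂ = τ₂ := by
  let P : Fin 5 → K := ![0, 1, 1, A, B]
  let Q : Fin 5 → K := ![1, 1, 0, 1, 1]
  have hT : ∀ x ∈ ({(moebiusPerm₁, τ₁), (moebiusPerm₂, τ₂)} :
      Set (alternatingGroup (Fin 5) × (K ≃ₐ[k] K))),
      ∀ i j l m, x.2 (crossRatio P Q i j l m) =
        crossRatio P Q (x.1.1 i) (x.1.1 j) (x.1.1 l) (x.1.1 m) := by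
    rintro x (rfl | rfl)
    · have p0 : moebiusPerm₁.1 0 = 1 := by decide
      have p1 : moebiusPerm₁.1 1 = 0 := by decide
      have p2 : moebiusPerm₁.1 2 = 3 := by decide
      have p3 : moebiusPerm₁.1 3 = 2 := by decide
      have p4 : moebiusPerm₁.1 4 = 4 := by decide
      refine map_crossRatio (τ₁ : K →+* K) moebiusPerm₁.1 P Q
        ![1 - A, -A, A * (A - 1), 1, B - A] A (-A) 1 (-A) ?_ ?_ ?_ ?_
      · rw [show A * -A - -A * 1 = -(A * (A - 1)) by ring]
        exact neg_ne_zero.2 (mul_ne_zero hA0 hA1)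
      · have hA1' : 1 - A ≠ 0 := by rwa [← neg_sub, neg_ne_zero]
        simp [Fin.forall_fin_succ, hA0, hA1, hBA, hA1']
      · simp [Fin.forall_fin_succ, P, Q, p0, p1, p2, p3, p4, h1A, h1B]
        refine ⟨?_, ?_⟩
        · ring
        · rw [mul_div_cancel₀ _ hBA]
          ring
      · simp [Fin.forall_fin_succ, P, Q, p0, p1, p2, p3, p4]
        exact ⟨sub_eq_add_neg _ _, sub_eq_add_neg _ _⟩
    · have p0 : moebiusPerm₂.1 0 = 0 := by decide
      have p1 : moebiusPerm₂.1 1 = 4 := by decide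
      have p2 : moebiusPerm₂.1 2 = 2 := by decide
      have p3 : moebiusPerm₂.1 3 = 1 := by decide
      have p4 : moebiusPerm₂.1 4 = 3 := by decide
      refine map_crossRatio (τ₂ : K →+* K) moebiusPerm₂.1 P Q ![B, B, 1, B, B] 1 0 0 B ?_ ?_ ?_ ?_
      · simpa using hB0
      · simp [Fin.forall_fin_succ, hB0]
      · simp [Fin.forall_fin_succ, P, Q, p0, p1, p2, p3, p4, h2A, h2B, hB0]
        field_simp
      · simp [Fin.forall_fin_succ, P, Q, p0, p1, p2, p3, p4]
  refine MonoidHom.exists_of_closure_pair closure_moebiusPerm fun g hg ↦ ?_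
  have hcr := crossRatio_of_mem_closure P Q _ hT hg
  exact hext g (by simpa [crossRatio, P, Q] using hcr 0 3 2 1)
    (by simpa [crossRatio, P, Q] using hcr 0 4 2 1)

/-- `a` and `b` are rational functions of `a` and `a(b-1)/(b-a)`. -/
lemma mem_adjoin_moebius₁ {k K : Type*} [Field k] [Field K] [Algebra k K] {A B : K}
    (hA0 : A ≠ 0) (hA1 : A - 1 ≠ 0) (hBA : B - A ≠ 0) (i : Fin 2) :
    ![A, B] i ∈ IntermediateField.adjoin k (Set.range ![A, A * (B - 1) / (B - A)]) := by
  set F := IntermediateField.adjoin k (Set.range ![A, A * (B - 1) / (B - A)])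
  have h0 : A ∈ F := IntermediateField.subset_adjoin _ _ ⟨0, rfl⟩
  have h1 : A * (B - 1) / (B - A) ∈ F := IntermediateField.subset_adjoin _ _ ⟨1, rfl⟩
  have hB : B = A * (A * (B - 1) / (B - A) - 1) / (A * (B - 1) / (B - A) - A) := by
    have e1 : A * (B - 1) / (B - A) - 1 = B * (A - 1) / (B - A) := by field_simp; ring
    have e2 : A * (B - 1) / (B - A) - A = A * (A - 1) / (B - A) := by field_simp; ring
    rw [e1, e2]
    field_simp
  revert i
  refine Fin.forall_fin_two.2 ⟨h0, ?_⟩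
  change B ∈ F
  rw [hB]
  exact div_mem (mul_mem h0 (sub_mem h1 (one_mem _))) (sub_mem h1 h0)

/-- `a` and `b` are rational functions of `1/b` and `a/b`. -/
lemma mem_adjoin_moebius₂ {k K : Type*} [Field k] [Field K] [Algebra k K] {A B : K}
    (hB0 : B ≠ 0) (i : Fin 2) :
    ![A, B] i ∈ IntermediateField.adjoin k (Set.range ![B⁻¹, A / B]) := by
  set F := IntermediateField.adjoin k (Set.range ![B⁻¹, A / B])
  have h0 : B⁻¹ ∈ F := IntermediateField.subset_adjoin _ _ ⟨0, rfl⟩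
  have h1 : A / B ∈ F := IntermediateField.subset_adjoin _ _ ⟨1, rfl⟩
  have hB : B ∈ F := by simpa using inv_mem h0
  revert i
  refine Fin.forall_fin_two.2 ⟨?_, hB⟩
  change A ∈ F
  rw [← div_mul_cancel₀ A hB0]
  exact mul_mem h1 hB

/-- A polynomial that does not vanish somewhere is nonzero as a rational function. -/
lemma MvPolynomial.algebraMap_fractionRing_ne_zero {k ι : Type*} [Field k] {p : MvPolynomial ι k}
    (v : ι → k) (h : eval v p ≠ 0) :
    algebraMap (MvPolynomial ι k) (FractionRing (MvPolynomial ι k)) p ≠ 0 := by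
  rw [Ne, IsFractionRing.to_map_eq_zero_iff]
  rintro rfl
  simp at h

/-- An automorphism of the rational function field over `k` fixing the variables is trivial. -/
lemma MvPolynomial.fractionRing_algEquiv_eq_one {k ι : Type*} [Field k]
    (g : FractionRing (MvPolynomial ι k) ≃ₐ[k] FractionRing (MvPolynomial ι k))
    (hg : ∀ i, g (algebraMap (MvPolynomial ι k) _ (X i)) = algebraMap (MvPolynomial ι k) _ (X i)) :
    g = 1 := by
  have hpoly : (g : FractionRing (MvPolynomial ι k) →ₐ[k] FractionRing (MvPolynomial ι k)).comp
      (IsScalarTower.toAlgHom k (MvPolynomial ι k) _) =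
        IsScalarTower.toAlgHom k (MvPolynomial ι k) _ := MvPolynomial.algHom_ext hg
  ext x
  obtain ⟨p, q, -, rfl⟩ := IsFractionRing.div_surjective (A := MvPolynomial ι k) x
  rw [map_div₀, AlgEquiv.one_apply]
  exact congrArg₂ _ (DFunLike.congr_fun hpoly p) (DFunLike.congr_fun hpoly q)


/-- The Möbius transformations permuting `{0, 1, ∞, a, b}` act on the parameters `(a,b)`
(generating a subgroup of `S₅` of permutations of the five points); the transformations
`τ₁(a,b) = (a, a(b-1)/(b-a))` and `τ₂(a,b) = (1/b, a/b)`, realized as automorphisms of the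
rational function field `k(a,b)`, satisfy `τ₁² = τ₂³ = (τ₁τ₂)⁵ = 1` and generate a group
isomorphic to `A₅`. -/
theorem moebius_transformations_generate_A5 {k : Type*} [Field k] [IsAlgClosed k] [CharZero k] :
    ∃ σ₁ σ₂ : RingAut (FractionRing (MvPolynomial (Fin 2) k)),
      (let A : FractionRing (MvPolynomial (Fin 2) k) :=
        algebraMap (MvPolynomial (Fin 2) k) _ (MvPolynomial.X 0);
      let B : FractionRing (MvPolynomial (Fin 2) k) :=
        algebraMap (MvPolynomial (Fin 2) k) _ (MvPolynomial.X 1);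
      (∀ u : k, σ₁ (algebraMap (MvPolynomial (Fin 2) k) _ (MvPolynomial.C u)) =
        algebraMap (MvPolynomial (Fin 2) k) _ (MvPolynomial.C u)) ∧
      (∀ u : k, σ₂ (algebraMap (MvPolynomial (Fin 2) k) _ (MvPolynomial.C u)) =
        algebraMap (MvPolynomial (Fin 2) k) _ (MvPolynomial.C u)) ∧
      σ₁ A = A ∧ σ₁ B = A * (B - 1) / (B - A) ∧
      σ₂ A = B⁻¹ ∧ σ₂ B = A / B) ∧
      σ₁ ^ 2 = 1 ∧ σ₂ ^ 3 = 1 ∧ (σ₁ * σ₂) ^ 5 = 1 ∧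
      (∃ f : Subgroup.closure {σ₁, σ₂} →* Equiv.Perm (Fin 5), Function.Injective f) ∧
      Nonempty ((Subgroup.closure {σ₁, σ₂} : Subgroup _) ≃* alternatingGroup (Fin 5)) := by
  let K := FractionRing (MvPolynomial (Fin 2) k)
  let ι : MvPolynomial (Fin 2) k →+* K := algebraMap _ _
  let A : K := ι (MvPolynomial.X 0)
  let B : K := ι (MvPolynomial.X 1)
  have hA0 : A ≠ 0 := MvPolynomial.algebraMap_fractionRing_ne_zero ![1, 0] (by simp)
  have hB0 : B ≠ 0 := MvPolynomial.algebraMap_fractionRing_ne_zero ![0, 1] (by simp)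
  have hA1 : A - 1 ≠ 0 := by
    rw [← map_one ι, ← map_sub ι]
    exact MvPolynomial.algebraMap_fractionRing_ne_zero ![0, 0] (by simp)
  have hBA : B - A ≠ 0 := by
    rw [← map_sub ι]
    exact MvPolynomial.algebraMap_fractionRing_ne_zero ![0, 1] (by simp)
  obtain ⟨τ₁, hτ₁⟩ := MvPolynomial.exists_fractionRing_algEquiv (k := k)
    ![A, A * (B - 1) / (B - A)] (Fin.forall_fin_two.2
      ⟨mem_adjoin_moebius₁ hA0 hA1 hBA 0, mem_adjoin_moebius₁ hA0 hA1 hBA 1⟩)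
  obtain ⟨τ₂, hτ₂⟩ := MvPolynomial.exists_fractionRing_algEquiv (k := k) ![B⁻¹, A / B]
    (Fin.forall_fin_two.2 ⟨mem_adjoin_moebius₂ hB0 0, mem_adjoin_moebius₂ hB0 1⟩)
  have h1A : τ₁ A = A := hτ₁ 0
  have h1B : τ₁ B = A * (B - 1) / (B - A) := hτ₁ 1
  have h2A : τ₂ A = B⁻¹ := hτ₂ 0
  have h2B : τ₂ B = A / B := hτ₂ 1
  obtain ⟨ψ, hψ₁, hψ₂⟩ := exists_hom_of_moebius hA0 hB0 hA1 hBA h1A h1B h2A h2B fun g hgA hgB ↦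
    MvPolynomial.fractionRing_algEquiv_eq_one g (Fin.forall_fin_two.2 ⟨hgA, hgB⟩)
  let Ψ : alternatingGroup (Fin 5) →* RingAut K :=
    (MulSemiringAction.toRingAut (K ≃ₐ[k] K) K).comp ψ
  have hΨ₁ (x : K) : Ψ moebiusPerm₁ x = τ₁ x := by rw [← hψ₁]; rfl
  have hΨ₂ (x : K) : Ψ moebiusPerm₂ x = τ₂ x := by rw [← hψ₂]; rfl
  have hC (u : k) : ι (MvPolynomial.C u) = algebraMap k K u :=
    (IsScalarTower.algebraMap_apply k (MvPolynomial (Fin 2) k) K u).symm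
  have hne : Ψ moebiusPerm₁ ≠ 1 := by
    intro h
    have hB : τ₁ B = B := by rw [← hΨ₁, h]; rfl
    rw [h1B, div_eq_iff hBA, ← sub_eq_zero, ← map_one ι, ← map_sub ι, ← map_sub ι, ← map_mul ι,
      ← map_mul ι, ← map_sub ι] at hB
    exact MvPolynomial.algebraMap_fractionRing_ne_zero ![1, 0] (by simp) hB
  obtain ⟨e⟩ := Ψ.nonempty_closure_pair_mulEquiv closure_moebiusPerm hne
  refine ⟨Ψ moebiusPerm₁, Ψ moebiusPerm₂, ⟨fun u ↦ ?_, fun u ↦ ?_, (hΨ₁ A).trans h1A,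
    (hΨ₁ B).trans h1B, (hΨ₂ A).trans h2A, (hΨ₂ B).trans h2B⟩, ?_, ?_, ?_, ?_, ⟨e⟩⟩
  · exact (hΨ₁ _).trans (by rw [hC, AlgEquiv.commutes])
  · exact (hΨ₂ _).trans (by rw [hC, AlgEquiv.commutes])
  · rw [← map_pow, moebiusPerm₁_sq, map_one]
  · rw [← map_pow, moebiusPerm₂_cube, map_one]
  · rw [← map_mul, ← map_pow, moebiusPerm₁_mul_moebiusPerm₂_pow, map_one]
  · exact ⟨(alternatingGroup (Fin 5)).subtype.comp e.toMonoidHom,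
      Subtype.val_injective.comp e.injective⟩
end
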